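/- (Uniqueness up to shift.) Let 0 < ρ₋ < ρ* < ρ₊ < 1 with f(ρ₋) = f(ρ₊), and let W and W̄ be two differentiable, monotone increasing solutions of the DDE W'(x) = (W(x)²/(ℓ φ(W(x)))) · [φ(W(x)) − φ(W(x + ℓ/W(x)))] on ℝ, both satisfying lim_{x→−∞} W = ρ₋ and lim_{x→+∞} W = ρ₊. Then there exists a constant c ∈ ℝ such that W̄(x) = W(x + c) for all x ∈ ℝ. -/

import Mathlib

open Real Set Filter Topology MeasureTheory

lemma tw_root (b T : ℝ) (hT : 0 < T) (hb : 1 < b * T) :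
    ∃ μ : ℝ, 0 < μ ∧ b * (1 - exp (-(μ * T))) = μ := by
  have hb0 : 0 < b := by
    by_contra h
    push Not at h
    nlinarith
  set μ0 := b - 1 / T with hμ0
  have h1 : 1 / T < b := by rw [div_lt_iff₀ hT]; exact hb
  have hT1 : 0 < 1 / T := by positivity
  have hμT : μ0 * T = b * T - 1 := by rw [hμ0]; field_simp
  have hle : μ0 ≤ b := by linarith
  have hcont : ContinuousOn (fun μ : ℝ => b * (1 - exp (-(μ * T))) - μ) (Icc μ0 b) := by
    fun_prop
  have hF0 : 0 ≤ b * (1 - exp (-(μ0 * T))) - μ0 := by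
    have he : b * T ≤ exp (μ0 * T) := by
      have := add_one_le_exp (μ0 * T)
      linarith
    have he2 : b * exp (-(μ0 * T)) ≤ 1 / T := by
      rw [Real.exp_neg, le_div_iff₀ hT, mul_assoc, mul_comm _ T, ← mul_assoc, ← div_eq_mul_inv,
        div_le_one (exp_pos _)]
      exact he
    nlinarith
  have hF1 : b * (1 - exp (-(b * T))) - b ≤ 0 := by
    have := exp_pos (-(b * T))
    nlinarith
  obtain ⟨μ, hμ, hm⟩ := intermediate_value_Icc' hle hcont ⟨hF1, hF0⟩
  refine ⟨μ, by have := hμ.1; linarith, ?_⟩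
  simp only at hm
  linarith

noncomputable def twQ (b μ T : ℝ) (v : ℝ → ℝ) (t : ℝ) : ℝ :=
  (b / μ) * ∫ s in t..t+T, (exp (μ * t) - exp (μ * (s - T))) * v s

lemma tw_window (T : ℝ) (v : ℝ → ℝ) (hv : Continuous v) (t : ℝ) :
    HasDerivAt (fun t => ∫ s in t..t+T, v s) (v (t + T) - v t) t := by
  have hG : ∀ x, HasDerivAt (fun x => ∫ s in (0:ℝ)..x, v s) (v x) x := fun x =>
    intervalIntegral.integral_hasDerivAt_right (hv.intervalIntegrable _ _)
      (hv.stronglyMeasurableAtFilter _ _) hv.continuousAt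
  have h1 : HasDerivAt (fun t => ∫ s in (0:ℝ)..(t+T), v s) (v (t+T)) t :=
    HasDerivAt.comp_add_const t T (hG (t + T))
  have := h1.sub (hG t)
  refine this.congr_of_eventuallyEq (Eventually.of_forall fun x => ?_)
  simp only [Pi.sub_apply]
  rw [intervalIntegral.integral_interval_sub_left (hv.intervalIntegrable _ _)
    (hv.intervalIntegrable _ _)]

lemma twQ_eq (b μ T : ℝ) (v : ℝ → ℝ) (hv : Continuous v) (t : ℝ) :
    twQ b μ T v t = (b / μ) * (exp (μ * t) * (∫ s in t..t+T, v s)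
      - exp (-(μ * T)) * ∫ s in t..t+T, exp (μ * s) * v s) := by
  unfold twQ
  congr 1
  rw [← intervalIntegral.integral_const_mul, ← intervalIntegral.integral_const_mul,
    ← intervalIntegral.integral_sub]
  · apply intervalIntegral.integral_congr
    intro s _
    simp only
    rw [show μ * (s - T) = -(μ * T) + μ * s by ring, Real.exp_add]
    ring
  · apply Continuous.intervalIntegrable; fun_prop
  · apply Continuous.intervalIntegrable; fun_prop

lemma twQ_deriv (b μ T : ℝ) (hμ : 0 < μ) (hr : b * (1 - exp (-(μ * T))) = μ)
    (v : ℝ → ℝ) (hv : Continuous v) (t : ℝ) :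
    HasDerivAt (twQ b μ T v) (exp (μ * t) * (b * (∫ s in t..t+T, v s) - v t)) t := by
  have h1 := tw_window T v hv t
  have h2 := tw_window T (fun s => exp (μ * s) * v s) (by fun_prop) t
  have h3 : HasDerivAt (fun t => exp (μ * t)) (exp (μ * t) * (μ * 1)) t :=
    ((hasDerivAt_id t).const_mul μ).exp
  have h4 := ((h3.mul h1).sub (h2.const_mul (exp (-(μ * T))))).const_mul (b / μ)
  have h5 := h4.congr_of_eventuallyEq (f₁ := twQ b μ T v)
    (Eventually.of_forall fun x => by simpa using twQ_eq b μ T v hv x)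
  refine h5.congr_deriv ?_
  have e : exp (-(μ * T)) * exp (μ * (t + T)) = exp (μ * t) := by
    rw [← Real.exp_add]; congr 1; ring
  have hbe : b * exp (-(μ * T)) = b - μ := by linarith
  field_simp
  linear_combination (-v (t+T) * b) * e + v t * exp (μ * t) * hbe

/-- upper bound of `twQ` for nonnegative functions -/
lemma twQ_le (b μ T : ℝ) (hb : 0 < b) (hT : 0 < T) (hμ : 0 < μ)
    (v : ℝ → ℝ) (hv : Continuous v) (t : ℝ) (h0 : ∀ s, t ≤ s → 0 ≤ v s) :
    twQ b μ T v t ≤ (b / μ) * (exp (μ * t) * ∫ s in t..t+T, v s) := by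
  unfold twQ
  apply mul_le_mul_of_nonneg_left _ (by positivity)
  rw [← intervalIntegral.integral_const_mul]
  apply intervalIntegral.integral_mono_on (by linarith)
    (Continuous.intervalIntegrable (by fun_prop) _ _)
    (Continuous.intervalIntegrable (by fun_prop) _ _)
  intro s hs
  apply mul_le_mul_of_nonneg_right _ (h0 s hs.1)
  have := exp_pos (μ * (s - T))
  linarith

lemma twQ_weight (μ T t s : ℝ) (hμ : 0 < μ) (hs : s ≤ t + T) :
    0 ≤ exp (μ * t) - exp (μ * (s - T)) := by
  rw [sub_nonneg]
  apply exp_le_exp.2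
  apply mul_le_mul_of_nonneg_left _ hμ.le
  linarith

lemma twQ_nonneg (b μ T : ℝ) (hb : 0 < b) (hT : 0 < T) (hμ : 0 < μ)
    (v : ℝ → ℝ) (t : ℝ) (h0 : ∀ s, t ≤ s → 0 ≤ v s) :
    0 ≤ twQ b μ T v t := by
  unfold twQ
  apply mul_nonneg (by positivity)
  apply intervalIntegral.integral_nonneg (by linarith)
  intro s hs
  exact mul_nonneg (twQ_weight μ T t s hμ hs.2) (h0 s hs.1)

lemma twQ_pos (b μ T : ℝ) (hb : 0 < b) (hT : 0 < T) (hμ : 0 < μ)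
    (v : ℝ → ℝ) (hv : Continuous v) (t : ℝ) (h0 : ∀ s, t ≤ s → 0 ≤ v s) (hp : 0 < v t) :
    0 < twQ b μ T v t := by
  unfold twQ
  apply mul_pos (by positivity)
  apply intervalIntegral.integral_pos (by linarith)
    (Continuous.continuousOn (by fun_prop))
  · intro s hs
    exact mul_nonneg (twQ_weight μ T t s hμ hs.2) (h0 s hs.1.le)
  · refine ⟨t, ⟨le_rfl, by linarith⟩, mul_pos ?_ hp⟩
    rw [sub_pos]
    apply exp_lt_exp.2
    apply mul_lt_mul_of_pos_left _ hμ
    linarith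

/-- lower bound of `twQ` for antitone nonnegative functions -/
lemma twQ_ge (b μ T : ℝ) (hb : 0 < b) (hT : 0 < T) (hμ : 0 < μ) :
    ∃ C : ℝ, 0 < C ∧ ∀ (v : ℝ → ℝ), Continuous v → Antitone v → (∀ s, 0 ≤ v s) → ∀ t,
    exp (μ * t) * (∫ s in t..t+T, v s) ≤ C * twQ b μ T v t := by
  set k := 1 - exp (-(μ * (T / 2))) with hk
  have hkpos : 0 < k := by
    rw [hk, sub_pos, exp_lt_one_iff]
    have : 0 < μ * (T / 2) := by positivity
    linarith
  refine ⟨2 * μ / (b * k), by positivity, ?_⟩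
  intro v hv ha h0 t
  have ii : ∀ x y, IntervalIntegrable v volume x y := fun x y => hv.intervalIntegrable x y
  have hsplit := intervalIntegral.integral_add_adjacent_intervals (ii t (t + T/2)) (ii (t+T/2) (t+T))
  have hA : (∫ s in (t+T/2)..(t+T), v s) ≤ ∫ s in t..(t+T/2), v s := by
    have e1 : (∫ s in (t+T/2)..(t+T), v s) ≤ ∫ s in (t+T/2)..(t+T), v (t+T/2) := by
      apply intervalIntegral.integral_mono_on (by linarith) (ii _ _) (by simp)
      intro s hs
      exact ha hs.1
    have e2 : (∫ s in t..(t+T/2), v (t+T/2)) ≤ ∫ s in t..(t+T/2), v s := by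
      apply intervalIntegral.integral_mono_on (by linarith) (by simp) (ii _ _)
      intro s hs
      exact ha hs.2
    simp only [intervalIntegral.integral_const, smul_eq_mul] at e1 e2
    nlinarith
  have hwc : Continuous (fun s => (exp (μ * t) - exp (μ * (s - T))) * v s) := by fun_prop
  have hsplit2 := intervalIntegral.integral_add_adjacent_intervals
    (hwc.intervalIntegrable (μ := volume) t (t + T/2))
    (hwc.intervalIntegrable (μ := volume) (t+T/2) (t+T))
  have hB : 0 ≤ ∫ s in (t+T/2)..(t+T), (exp (μ * t) - exp (μ * (s - T))) * v s := by
    apply intervalIntegral.integral_nonneg (by linarith)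
    intro s hs
    exact mul_nonneg (twQ_weight μ T t s hμ hs.2) (h0 s)
  have hC : exp (μ * t) * k * (∫ s in t..(t+T/2), v s) ≤
      ∫ s in t..(t+T/2), (exp (μ * t) - exp (μ * (s - T))) * v s := by
    rw [← intervalIntegral.integral_const_mul]
    apply intervalIntegral.integral_mono_on (by linarith)
      (Continuous.intervalIntegrable (by fun_prop) _ _) (hwc.intervalIntegrable _ _)
    intro s hs
    apply mul_le_mul_of_nonneg_right _ (h0 s)
    have : exp (μ * (s - T)) ≤ exp (μ * t) * exp (-(μ * (T / 2))) := by
      rw [← Real.exp_add]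
      apply exp_le_exp.2
      have := hs.2
      nlinarith
    rw [hk]; linarith
  unfold twQ
  rw [← hsplit2, ← hsplit]
  have he := exp_pos (μ * t)
  have : 2 * μ / (b * k) * (b / μ * ((∫ s in t..(t+T/2), (exp (μ * t) - exp (μ * (s - T))) * v s) + ∫ s in (t+T/2)..(t+T), (exp (μ * t) - exp (μ * (s - T))) * v s))
     = (2 / k) * ((∫ s in t..(t+T/2), (exp (μ * t) - exp (μ * (s - T))) * v s) + ∫ s in (t+T/2)..(t+T), (exp (μ * t) - exp (μ * (s - T))) * v s) := by
    field_simp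
  rw [this]
  calc _ ≤ exp (μ * t) * (2 * ∫ s in t..(t+T/2), v s) := by
        apply mul_le_mul_of_nonneg_left _ he.le; linarith
    _ = (2 / k) * (exp (μ * t) * k * (∫ s in t..(t+T/2), v s)) := by field_simp
    _ ≤ _ := by
        apply mul_le_mul_of_nonneg_left _ (by positivity)
        linarith

lemma tw_int_exp (l T t : ℝ) (hl : 0 < l) :
    (∫ s in t..t+T, exp (-(l * s))) = exp (-(l * t)) * (1 - exp (-(l * T))) / l := by
  have h : ∀ x ∈ uIcc t (t+T), HasDerivAt (fun s => -(exp (-(l * s))) / l) (exp (-(l * x))) x := by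
    intro x _
    have h3 : HasDerivAt (fun s => exp (-(l * s))) (exp (-(l * x)) * (-(l * 1))) x :=
      (((hasDerivAt_id x).const_mul l).neg).exp
    refine (h3.neg.div_const l).congr_deriv ?_
    field_simp
  rw [intervalIntegral.integral_eq_sub_of_hasDerivAt h
    (Continuous.intervalIntegrable (by fun_prop) _ _)]
  rw [show -(l * (t + T)) = -(l * t) + -(l * T) by ring, Real.exp_add]
  field_simp
  ring

lemma twQ_lin (b μ T N : ℝ) (v w : ℝ → ℝ) (hv : Continuous v) (hw : Continuous w) (t : ℝ) :
    twQ b μ T (fun s => N * w s - v s) t = N * twQ b μ T w t - twQ b μ T v t := by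
  unfold twQ
  rw [mul_left_comm, ← mul_sub]
  congr 1
  rw [← intervalIntegral.integral_const_mul, ← intervalIntegral.integral_sub]
  · apply intervalIntegral.integral_congr
    intro s _
    simp only
    ring
  · apply Continuous.intervalIntegrable; fun_prop
  · apply Continuous.intervalIntegrable; fun_prop

lemma tw_kappa (a l T : ℝ) (ha : 0 < a) (hT : 0 < T) (hl : 0 < l)
    (hr : a * (1 - exp (-(l * T))) = l) :
    ∃ κ : ℝ, 0 < κ ∧ ∀ t, twQ a l T (fun s => exp (-(l * s))) t = κ := by
  have hc : Continuous (fun s => exp (-(l * s))) := by fun_prop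
  have hd : ∀ t, HasDerivAt (twQ a l T (fun s => exp (-(l * s)))) 0 t := by
    intro t
    refine (twQ_deriv a l T hl hr _ hc t).congr_deriv ?_
    rw [tw_int_exp l T t hl]
    have : a * (exp (-(l * t)) * (1 - exp (-(l * T))) / l) = exp (-(l*t)) := by
      field_simp
      linear_combination hr
    rw [this]; simp
  refine ⟨twQ a l T (fun s => exp (-(l * s))) 0,
    twQ_pos a l T ha hT hl _ hc 0 (fun s _ => (exp_pos _).le) (exp_pos _), fun t => ?_⟩
  exact is_const_of_deriv_eq_zero (fun x => (hd x).differentiableAt) (fun x => (hd x).deriv) t 0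

lemma tw_limsup (a l T κ L B : ℝ) (ha : 0 < a) (hT : 0 < T) (hl : 0 < l)
    (hr : a * (1 - exp (-(l * T))) = l) (hκ : 0 < κ)
    (hκQ : ∀ t, twQ a l T (fun s => exp (-(l * s))) t = κ)
    (v : ℝ → ℝ) (hv : Continuous v)
    (hB : ∀ᶠ t in atTop, |exp (l * t) * v t| ≤ B)
    (he : Tendsto (fun t => exp (l * t) * (a * (∫ s in t..t+T, v s) - v t)) atTop (𝓝 0))
    (hQ : Tendsto (twQ a l T v) atTop (𝓝 L)) (ε : ℝ) (hε : 0 < ε) :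
    ∀ᶠ t in atTop, exp (l * t) * v t < L / κ + ε := by
  set y : ℝ → ℝ := fun t => exp (l * t) * v t with hy
  have hbd1 : IsBoundedUnder (· ≤ ·) atTop y :=
    ⟨B, by simpa using hB.mono fun t h => (abs_le.1 h).2⟩
  have hbd2 : IsBoundedUnder (· ≥ ·) atTop y :=
    ⟨-B, by simpa using hB.mono fun t h => (abs_le.1 h).1⟩
  set M := limsup y atTop with hM
  suffices hML : M * κ ≤ L by
    apply eventually_lt_of_limsup_lt _ hbd1
    have : M ≤ L / κ := by rw [le_div_iff₀ hκ]; exact hML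
    change M < _
    linarith
  have key : ∀ δ > 0, M * κ ≤ L + δ * (1 + 3 / l) := by
    intro δ hδ
    have hf : ∃ᶠ t in atTop, M - δ < y t :=
      frequently_lt_of_lt_limsup hbd2.isCoboundedUnder_le (by linarith)
    have h1 : ∀ᶠ t in atTop, ∀ s ≥ t, y s < M + δ :=
      eventually_forall_ge_atTop.2 (eventually_lt_of_limsup_lt (by linarith) hbd1)
    have h2 := he.eventually (lt_mem_nhds (show -δ < 0 by linarith))
    have h3 := hQ.eventually (gt_mem_nhds (show L < L + δ by linarith))
    obtain ⟨t, ht0, ht1, ht2, ht3⟩ := (hf.and_eventually (h1.and (h2.and h3))).exists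
    have hc : Continuous (fun s => exp (-(l * s))) := by fun_prop
    have hr0 : ∀ s, t ≤ s → 0 ≤ (M + δ) * exp (-(l * s)) - v s := by
      intro s hs
      have := ht1 s hs
      have e1 : exp (-(l * s)) * exp (l * s) = 1 := by rw [← Real.exp_add]; simp
      have e2 : v s = exp (-(l * s)) * y s := by
        simp only [hy]; rw [← mul_assoc, e1, one_mul]
      rw [e2]
      nlinarith [exp_pos (-(l * s))]
    have hle := twQ_le a l T ha hT hl (fun s => (M + δ) * exp (-(l * s)) - v s) (by fun_prop) t hr0
    rw [twQ_lin _ _ _ _ _ _ hv hc, hκQ, intervalIntegral.integral_sub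
      (Continuous.intervalIntegrable (by fun_prop) _ _) (hv.intervalIntegrable _ _),
      intervalIntegral.integral_const_mul, tw_int_exp l T t hl] at hle
    have e1 : exp (l * t) * exp (-(l * t)) = 1 := by rw [← Real.exp_add]; simp
    have e3 : a / l * (exp (l * t) * ((M + δ) * (exp (-(l * t)) * (1 - exp (-(l * T))) / l) - ∫ s in t..t+T, v s))
      = (1 / l) * ((M + δ) - exp (l * t) * (a * ∫ s in t..t+T, v s)) := by
      field_simp
      linear_combination (M + δ) * a * (1 - exp (-(l * T))) * e1 + (M + δ) * hr
    rw [e3] at hle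
    have h4 : (1 / l) * ((M + δ) - exp (l * t) * (a * ∫ s in t..t+T, v s)) ≤ (1 / l) * (3 * δ) := by
      apply mul_le_mul_of_nonneg_left _ (by positivity)
      simp only [hy] at ht0
      rw [mul_sub] at ht2
      linarith
    have h5 : (1 / l) * (3 * δ) = δ * (3 / l) := by ring
    have h6 := mul_pos hδ hκ
    nlinarith
  apply le_of_forall_pos_le_add
  intro ε' hε'
  have hp : 0 < 1 + 3 / l := by positivity
  have := key (ε' / (1 + 3 / l)) (by positivity)
  rwa [div_mul_cancel₀ _ hp.ne'] at this

lemma tw_asymp (a l T K : ℝ) (hT : 0 < T) (haT : 1 < a * T) (hl : 0 < l) (hK : 0 ≤ K)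
    (hr : a * (1 - exp (-(l * T))) = l)
    (v : ℝ → ℝ) (hv : Continuous v) (hanti : Antitone v) (h0 : ∀ t, 0 ≤ v t)
    (h1 : ∀ t, v t ≤ a * ∫ s in t..t+T, v s)
    (h2 : ∀ t, a * (∫ s in t..t+T, v s) - v t ≤ K * v t * ∫ s in t..t+T, v s)
    (hlim : Tendsto v atTop (𝓝 0)) (hne : ∃ t, 0 < v t) :
    ∃ L, 0 < L ∧ Tendsto (fun t => exp (l * t) * v t) atTop (𝓝 L) := by
  have hI0 : ∀ t, 0 ≤ ∫ s in t..t+T, v s := fun t =>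
    intervalIntegral.integral_nonneg (by linarith) fun s _ => h0 s
  have h1T : 1 / T < a := by rw [div_lt_iff₀ hT]; exact haT
  have hT1 : 0 < 1 / T := by positivity
  have ha : 0 < a := by linarith
  set b := (a + 1 / T) / 2 with hb
  have hb0 : 0 < b := by linarith
  have hba : b < a := by linarith
  have hbT : 1 < b * T := by rw [← div_lt_iff₀ hT]; linarith
  obtain ⟨μ, hμ, hμr⟩ := tw_root b T hT hbT
  obtain ⟨t0, ht0⟩ := eventually_atTop.1
    (hlim.eventually (gt_mem_nhds (show 0 < (a - b) / (K + 1) by apply div_pos <;> linarith)))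
  have hbI : ∀ t ≥ t0, b * (∫ s in t..t+T, v s) ≤ v t := by
    intro t ht
    have e1 := ht0 t ht
    rw [lt_div_iff₀ (by linarith)] at e1
    have e2 : K * v t ≤ a - b := by nlinarith [h0 t]
    have := mul_le_mul_of_nonneg_right e2 (hI0 t)
    linarith [h2 t]
  obtain ⟨C1, hC1, hC1b⟩ := twQ_ge b μ T hb0 hT hμ
  obtain ⟨C2, hC2, hC2b⟩ := twQ_ge a l T ha hT hl
  have hQbd := fun t => twQ_deriv b μ T hμ hμr v hv t
  have hQb : AntitoneOn (twQ b μ T v) (Ici t0) := by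
    apply antitoneOn_of_deriv_nonpos (convex_Ici t0)
      (fun t _ => (hQbd t).continuousAt.continuousWithinAt)
      (fun t _ => (hQbd t).differentiableAt.differentiableWithinAt)
    intro t ht
    rw [(hQbd t).deriv]
    rw [interior_Ici] at ht
    have := hbI t (le_of_lt ht)
    exact mul_nonpos_of_nonneg_of_nonpos (exp_pos _).le (by linarith)
  set A := a * (C1 * twQ b μ T v t0) with hA
  have hA0 : 0 ≤ A := by
    have := twQ_nonneg b μ T hb0 hT hμ v t0 fun s _ => h0 s
    positivity
  have hdec : ∀ t ≥ t0, v t ≤ A * exp (-(μ * t)) := by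
    intro t ht
    have e1 := hC1b v hv hanti h0 t
    have e2 := hQb self_mem_Ici ht ht
    have e3 : exp (μ * t) * v t ≤ A := by
      calc exp (μ * t) * v t ≤ exp (μ * t) * (a * ∫ s in t..t+T, v s) :=
            mul_le_mul_of_nonneg_left (h1 t) (exp_pos _).le
        _ = a * (exp (μ * t) * ∫ s in t..t+T, v s) := by ring
        _ ≤ A := by
            apply mul_le_mul_of_nonneg_left _ ha.le
            exact e1.trans (mul_le_mul_of_nonneg_left e2 hC1.le)
    rw [Real.exp_neg, ← div_eq_mul_inv, le_div_iff₀ (exp_pos _)]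
    linarith
  have hQd := fun t => twQ_deriv a l T hl hr v hv t
  have hQ0 : ∀ t, 0 ≤ twQ a l T v t := fun t => twQ_nonneg a l T ha hT hl v t fun s _ => h0 s
  have hQmono : Monotone (twQ a l T v) := by
    apply monotone_of_deriv_nonneg (fun t => (hQd t).differentiableAt)
    intro t
    rw [(hQd t).deriv]
    exact mul_nonneg (exp_pos _).le (by linarith [h1 t])
  set D := K * A * C2 with hD
  have hD0 : 0 ≤ D := by positivity
  have hQ'le : ∀ t ≥ t0, exp (l * t) * (a * (∫ s in t..t+T, v s) - v t) ≤
      D * exp (-(μ * t)) * twQ a l T v t := by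
    intro t ht
    calc _ ≤ exp (l * t) * (K * v t * ∫ s in t..t+T, v s) :=
          mul_le_mul_of_nonneg_left (h2 t) (exp_pos _).le
      _ = (K * v t) * (exp (l * t) * ∫ s in t..t+T, v s) := by ring
      _ ≤ (K * (A * exp (-(μ * t)))) * (C2 * twQ a l T v t) := by
          apply mul_le_mul (mul_le_mul_of_nonneg_left (hdec t ht) hK) (hC2b v hv hanti h0 t)
            (mul_nonneg (exp_pos _).le (hI0 t))
          positivity
      _ = _ := by rw [hD]; ring
  set R : ℝ → ℝ := fun t => twQ a l T v t * exp (D / μ * exp (-(μ * t))) with hR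
  have hRd : ∀ t, HasDerivAt R ((exp (l * t) * (a * (∫ s in t..t+T, v s) - v t) -
      D * exp (-(μ * t)) * twQ a l T v t) * exp (D / μ * exp (-(μ * t)))) t := by
    intro t
    have h3 : HasDerivAt (fun s => exp (-(μ * s))) (exp (-(μ * t)) * (-(μ * 1))) t :=
      (((hasDerivAt_id t).const_mul μ).neg).exp
    refine ((hQd t).mul (h3.const_mul (D / μ)).exp).congr_deriv ?_
    field_simp
    ring
  have hRanti : AntitoneOn R (Ici t0) := by
    apply antitoneOn_of_deriv_nonpos (convex_Ici t0)
      (fun t _ => (hRd t).continuousAt.continuousWithinAt)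
      (fun t _ => (hRd t).differentiableAt.differentiableWithinAt)
    intro t ht
    rw [(hRd t).deriv]
    rw [interior_Ici] at ht
    have := hQ'le t (le_of_lt ht)
    exact mul_nonpos_of_nonpos_of_nonneg (by linarith) (exp_pos _).le
  set B0 := R t0 with hB0
  have hQle : ∀ t ≥ t0, twQ a l T v t ≤ B0 := by
    intro t ht
    have e1 := hRanti self_mem_Ici ht ht
    refine le_trans ?_ e1
    simp only [hR]
    have : 1 ≤ exp (D / μ * exp (-(μ * t))) := by
      apply one_le_exp; positivity
    nlinarith [hQ0 t]
  have hbdd : BddAbove (range (twQ a l T v)) := by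
    refine ⟨B0, ?_⟩
    rintro _ ⟨t, rfl⟩
    rcases le_total t0 t with h | h
    · exact hQle t h
    · exact (hQmono h).trans (hQle t0 le_rfl)
  set L := ⨆ t, twQ a l T v t with hL
  have hQL : Tendsto (twQ a l T v) atTop (𝓝 L) := tendsto_atTop_ciSup hQmono hbdd
  have hLpos : 0 < L := by
    obtain ⟨t, ht⟩ := hne
    exact (twQ_pos a l T ha hT hl v hv t (fun s _ => h0 s) ht).trans_le (le_ciSup hbdd t)
  have hB00 : 0 ≤ B0 := (hQ0 t0).trans (hQle t0 le_rfl)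
  have hexp0 : Tendsto (fun t => D * B0 * exp (-(μ * t))) atTop (𝓝 0) := by
    have : Tendsto (fun t => exp (-(μ * t))) atTop (𝓝 0) :=
      tendsto_exp_neg_atTop_nhds_zero.comp (tendsto_id.const_mul_atTop hμ)
    simpa using this.const_mul (D * B0)
  have he : Tendsto (fun t => exp (l * t) * (a * (∫ s in t..t+T, v s) - v t)) atTop (𝓝 0) := by
    apply tendsto_of_tendsto_of_tendsto_of_le_of_le' tendsto_const_nhds hexp0
    · exact Eventually.of_forall fun t => mul_nonneg (exp_pos _).le (by linarith [h1 t])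
    · filter_upwards [eventually_ge_atTop t0] with t ht
      refine (hQ'le t ht).trans ?_
      calc _ ≤ D * exp (-(μ * t)) * B0 :=
            mul_le_mul_of_nonneg_left (hQle t ht) (by positivity)
        _ = _ := by ring
  have hB : ∀ᶠ t in atTop, |exp (l * t) * v t| ≤ a * (C2 * B0) := by
    filter_upwards [eventually_ge_atTop t0] with t ht
    rw [abs_of_nonneg (mul_nonneg (exp_pos _).le (h0 t))]
    calc exp (l * t) * v t ≤ exp (l * t) * (a * ∫ s in t..t+T, v s) :=
          mul_le_mul_of_nonneg_left (h1 t) (exp_pos _).le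
      _ = a * (exp (l * t) * ∫ s in t..t+T, v s) := by ring
      _ ≤ _ := by
        apply mul_le_mul_of_nonneg_left _ ha.le
        exact (hC2b v hv hanti h0 t).trans (mul_le_mul_of_nonneg_left (hQle t ht) hC2.le)
  obtain ⟨κ, hκ, hκQ⟩ := tw_kappa a l T ha hT hl hr
  refine ⟨L / κ, by positivity, ?_⟩
  have hup := tw_limsup a l T κ L _ ha hT hl hr hκ hκQ v hv hB he hQL
  have hnegQ : twQ a l T (fun s => -v s) = fun t => -twQ a l T v t := by
    funext t
    have := twQ_lin a l T 0 v v hv hv t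
    simpa using this
  have hlo := tw_limsup a l T κ (-L) (a * (C2 * B0)) ha hT hl hr hκ hκQ (fun s => -v s) hv.neg
    (by simpa using hB)
    (by
      have := he.neg
      rw [neg_zero] at this
      refine this.congr fun t => ?_
      rw [intervalIntegral.integral_neg]; ring)
    (by rw [hnegQ]; exact hQL.neg)
  rw [Metric.tendsto_nhds]
  intro ε hε
  filter_upwards [hup ε hε, hlo ε hε] with t e1 e2
  rw [Real.dist_eq, abs_lt]
  rw [neg_div] at e2
  constructor <;> linarith

lemma tw_abs (a T K B : ℝ) (hT : 0 < T) (haT : 1 < a * T) (hK : 0 ≤ K) (h : ℝ → ℝ)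
    (hlip : ∀ x ∈ Icc 0 B, ∀ y ∈ Icc 0 B, |h x - h y| ≤ a * |x - y|) (hh0 : h 0 = 0)
    (hlow : ∀ x ∈ Icc 0 B, a * x - K * x ^ 2 ≤ h x)
    (v w : ℝ → ℝ)
    (hv : Continuous v) (hva : Antitone v) (hvm : ∀ t, v t ∈ Icc 0 B)
    (hvc : Continuous fun t => h (v t)) (hvl : Tendsto v atTop (𝓝 0)) (hvp : ∃ t, 0 < v t)
    (hve : ∀ t, v t = ∫ s in t..t+T, h (v s))
    (hw : Continuous w) (hwa : Antitone w) (hwm : ∀ t, w t ∈ Icc 0 B)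
    (hwc : Continuous fun t => h (w t)) (hwl : Tendsto w atTop (𝓝 0)) (hwp : ∃ t, 0 < w t)
    (hwe : ∀ t, w t = ∫ s in t..t+T, h (w s)) :
    ∃ c, ∀ t, w t = v (t + c) := by
  have ha : 0 < a := by
    by_contra h
    push Not at h
    nlinarith
  obtain ⟨l, hl, hr⟩ := tw_root a T hT haT
  have asy : ∀ v : ℝ → ℝ, Continuous v → Antitone v → (∀ t, v t ∈ Icc 0 B) →
      (Continuous fun t => h (v t)) → Tendsto v atTop (𝓝 0) → (∃ t, 0 < v t) →
      (∀ t, v t = ∫ s in t..t+T, h (v s)) →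
      ∃ L, 0 < L ∧ Tendsto (fun t => exp (l * t) * v t) atTop (𝓝 L) := by
    intro v hv hva hvm hvc hvl hvp hve
    apply tw_asymp a l T K hT haT hl hK hr v hv hva (fun t => (hvm t).1) _ _ hvl hvp
    · intro t
      rw [← intervalIntegral.integral_const_mul, hve t]
      apply intervalIntegral.integral_mono_on (by linarith) (hvc.intervalIntegrable _ _)
        (Continuous.intervalIntegrable (by fun_prop) _ _)
      intro s _
      have hb := hvm s
      have := hlip (v s) hb 0 ⟨le_rfl, hb.1.trans hb.2⟩
      rw [hh0, sub_zero, sub_zero, abs_of_nonneg hb.1] at this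
      exact (le_abs_self _).trans this
    · intro t
      rw [sub_le_iff_le_add, ← sub_le_iff_le_add', ← intervalIntegral.integral_const_mul,
        ← intervalIntegral.integral_const_mul, ← intervalIntegral.integral_sub
        (Continuous.intervalIntegrable (by fun_prop) _ _)
        (Continuous.intervalIntegrable (by fun_prop) _ _)]
      conv_rhs => rw [hve t]
      apply intervalIntegral.integral_mono_on (by linarith)
        (Continuous.intervalIntegrable (by fun_prop) _ _) (hvc.intervalIntegrable _ _)
      intro s hs
      have e1 := hlow (v s) (hvm s)
      have e2 : K * v s * v s ≤ K * v t * v s :=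
        mul_le_mul_of_nonneg_right (mul_le_mul_of_nonneg_left (hva hs.1) hK) (hvm s).1
      nlinarith
  obtain ⟨L1, hL1, hl1⟩ := asy v hv hva hvm hvc hvl hvp hve
  obtain ⟨L2, hL2, hl2⟩ := asy w hw hwa hwm hwc hwl hwp hwe
  set c := log (L1 / L2) / l with hc
  have hcl : exp (l * c) = L1 / L2 := by
    rw [hc, mul_div_cancel₀ _ hl.ne', exp_log (by positivity)]
  refine ⟨c, ?_⟩
  set d : ℝ → ℝ := fun t => |w t - v (t + c)| with hd
  have hdc : Continuous d := by fun_prop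
  have hd0 : ∀ t, 0 ≤ d t := fun t => abs_nonneg _
  have hdlim : Tendsto (fun t => exp (l * t) * d t) atTop (𝓝 0) := by
    have e1 := (hl1.comp (tendsto_atTop_add_const_right atTop c tendsto_id)).const_mul (exp (-(l*c)))
    have e2 := (hl2.sub e1).abs
    have e3 : L2 - exp (-(l * c)) * L1 = 0 := by
      rw [Real.exp_neg, hcl]; field_simp; ring
    rw [e3, abs_zero] at e2
    refine e2.congr fun t => ?_
    simp only [Function.comp, id, hd]
    rw [← abs_of_pos (exp_pos (l * t)), ← abs_mul, abs_of_pos (exp_pos (l * t)), ← mul_assoc,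
      ← Real.exp_add]
    congr 1
    rw [show -(l * c) + l * (t + c) = l * t by ring]
    ring
  have hdI : ∀ t, d t ≤ a * ∫ s in t..t+T, d s := by
    intro t
    have e0 : v (t + c) = ∫ s in t..t+T, h (v (s + c)) := by
      rw [hve (t + c), intervalIntegral.integral_comp_add_right (fun s => h (v s)) c]
      congr 1; ring
    have hvc' : Continuous fun s => h (v (s + c)) := hvc.comp (continuous_id.add continuous_const)
    simp only [hd]
    rw [e0]
    conv_lhs => rw [hwe t]
    rw [← intervalIntegral.integral_sub (hwc.intervalIntegrable _ _) (hvc'.intervalIntegrable _ _)]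
    refine (intervalIntegral.abs_integral_le_integral_abs (by linarith)).trans ?_
    rw [← intervalIntegral.integral_const_mul]
    apply intervalIntegral.integral_mono_on (by linarith)
      ((hwc.sub hvc').abs.intervalIntegrable _ _)
      (Continuous.intervalIntegrable (by fun_prop) _ _)
    intro s _
    exact hlip _ (hwm s) _ (hvm _)
  have hQd := fun t => twQ_deriv a l T hl hr d hdc t
  have hQmono : Monotone (twQ a l T d) := by
    apply monotone_of_deriv_nonneg (fun t => (hQd t).differentiableAt)
    intro t
    rw [(hQd t).deriv]
    exact mul_nonneg (exp_pos _).le (by linarith [hdI t])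
  intro t
  by_contra hne
  have hdt : 0 < d t := abs_pos.2 (sub_ne_zero.2 hne)
  have hq := twQ_pos a l T ha hT hl d hdc t (fun s _ => hd0 s) hdt
  set q := twQ a l T d t with hqd
  set ε := q * l / (2 * a * T) with hε
  have hεp : 0 < ε := by positivity
  obtain ⟨t1, ht1⟩ := eventually_atTop.1 (hdlim.eventually (gt_mem_nhds hεp))
  set t2 := max t t1 with ht2
  have f1 := hQmono (le_max_left t t1)
  have f2 := twQ_le a l T ha hT hl d hdc t2 (fun s _ => hd0 s)
  have f3 : exp (l * t2) * (∫ s in t2..t2+T, d s) ≤ T * ε := by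
    rw [← intervalIntegral.integral_const_mul]
    have : (∫ s in t2..t2+T, exp (l * t2) * d s) ≤ ∫ s in t2..t2+T, ε := by
      apply intervalIntegral.integral_mono_on (by linarith)
        (Continuous.intervalIntegrable (by fun_prop) _ _) (by simp)
      intro s hs
      have g1 := ht1 s ((le_max_right t t1).trans hs.1)
      refine le_trans ?_ g1.le
      apply mul_le_mul_of_nonneg_right _ (hd0 s)
      exact exp_le_exp.2 (mul_le_mul_of_nonneg_left hs.1 hl.le)
    simpa using this
  have f4 : a / l * (T * ε) = q / 2 := by rw [hε]; field_simp
  have f5 := mul_le_mul_of_nonneg_left f3 (show 0 ≤ a / l by positivity)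
  have f6 : q ≤ twQ a l T d t2 := f1
  linarith

lemma tw_param (ℓ ρp : ℝ) (hℓ : 0 < ℓ) (hρ0 : 0 < ρp) (hρ1 : ρp < 1)
    (φ : ℝ → ℝ) (hφc : Continuous φ) (hpos : ∀ ρ ∈ Ioo (0:ℝ) 1, 0 < φ ρ)
    (hle : ∀ ρ ∈ Ioo (0:ℝ) 1, φ ρ ≤ 1) (hanti : AntitoneOn φ (Icc 0 1))
    (W : ℝ → ℝ) (hWmem : ∀ x, W x ∈ Ioo (0:ℝ) 1)
    (hWmono : Monotone W) (hWd : Differentiable ℝ W)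
    (hdde : ∀ x, deriv W x =
      W x ^ 2 / (ℓ * φ (W x)) * (φ (W x) - φ (W (x + ℓ / W x))))
    (hWlimp : Tendsto W atTop (𝓝 ρp)) :
    ∃ z : ℝ → ℝ, Function.Surjective z ∧ Monotone z ∧ Tendsto z atTop atTop ∧
      (∀ t, HasDerivAt z (φ (W (z t))) t) ∧
      ∀ t, z (t + ℓ / (ρp * φ ρp)) = z t + ℓ / W (z t) := by
  have hWc : Continuous W := hWd.continuous
  have hφW : ∀ x, 0 < φ (W x) := fun x => hpos _ (hWmem x)
  have hφp : 0 < φ ρp := hpos _ ⟨hρ0, hρ1⟩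
  set q : ℝ → ℝ := fun x => (φ (W x))⁻¹ with hq
  have hqc : Continuous q := (hφc.comp hWc).inv₀ fun x => (hφW x).ne'
  have hq1 : ∀ x, 1 ≤ q x := fun x => (one_le_inv₀ (hφW x)).2 (hle _ (hWmem x))
  set Θ : ℝ → ℝ := fun x => ∫ s in (0:ℝ)..x, q s with hΘ
  have hΘd : ∀ x, HasDerivAt Θ (q x) x := fun x =>
    intervalIntegral.integral_hasDerivAt_right (hqc.intervalIntegrable _ _)
      (hqc.stronglyMeasurableAtFilter _ _) hqc.continuousAt
  have hΘ0 : Θ 0 = 0 := by simp [hΘ]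
  have hΘm : StrictMono Θ := by
    apply strictMono_of_deriv_pos
    intro x
    rw [(hΘd x).deriv]
    linarith [hq1 x]
  have hΘc : Continuous Θ := continuous_iff_continuousAt.2 fun x => (hΘd x).continuousAt
  have hΘi : Monotone (fun x => Θ x - x) := by
    have hd : ∀ x, HasDerivAt (fun x => Θ x - x) (q x - 1) x := fun x =>
      (hΘd x).sub (hasDerivAt_id x)
    apply monotone_of_deriv_nonneg (fun t => (hd t).differentiableAt)
    intro x
    rw [(hd x).deriv]
    linarith [hq1 x]
  have htop : Tendsto Θ atTop atTop := by
    apply tendsto_atTop_mono' atTop _ tendsto_id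
    filter_upwards [eventually_ge_atTop 0] with x hx
    have := hΘi hx
    simp only [hΘ0] at this
    simp only [id]; linarith
  have hbot : Tendsto Θ atBot atBot := by
    apply tendsto_atBot_mono' atBot _ tendsto_id
    filter_upwards [eventually_le_atBot 0] with x hx
    have := hΘi hx
    simp only [hΘ0] at this
    simp only [id]; linarith
  have hsurj : Function.Surjective Θ := hΘc.surjective htop hbot
  set e := StrictMono.orderIsoOfSurjective Θ hΘm hsurj with he
  have heΘ : ∀ x, e x = Θ x := fun x => rfl
  set z : ℝ → ℝ := fun t => e.symm t with hz
  have hzΘ : ∀ x, z (Θ x) = x := fun x => e.symm_apply_apply x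
  have hΘz : ∀ t, Θ (z t) = t := fun t => e.apply_symm_apply t
  -- constancy of the travel time
  have hS : ∀ x, HasDerivAt (fun x => Θ (x + ℓ / W x) - Θ x) 0 x := by
    intro x
    have hW0 : W x ≠ 0 := (hWmem x).1.ne'
    have hWx := (hWd x).hasDerivAt
    have h1 : HasDerivAt (fun x => x + ℓ / W x) (1 + ℓ * (-deriv W x / W x ^ 2)) x := by
      have : HasDerivAt (fun x => x + ℓ * (W x)⁻¹) (1 + ℓ * (-deriv W x / W x ^ 2)) x :=
        (hasDerivAt_id x).add ((hWx.inv hW0).const_mul ℓ)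
      simpa [div_eq_mul_inv] using this
    have h2 := HasDerivAt.comp x (hΘd (x + ℓ / W x)) h1
    refine (h2.sub (hΘd x)).congr_deriv ?_
    rw [hdde x]
    simp only [hq]
    have a1 := (hφW x).ne'
    have a2 := (hφW (x + ℓ / W x)).ne'
    have a3 := hℓ.ne'
    generalize φ (W (x + ℓ / W x)) = A at *
    field_simp
    ring
  have hconst : ∀ x, Θ (x + ℓ / W x) - Θ x = Θ (0 + ℓ / W 0) - Θ 0 := fun x =>
    is_const_of_deriv_eq_zero (fun x => (hS x).differentiableAt) (fun x => (hS x).deriv) x 0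
  have hWle : ∀ x, W x ≤ ρp := fun x => hWmono.ge_of_tendsto hWlimp x
  have hT : Θ (0 + ℓ / W 0) - Θ 0 = ℓ / (ρp * φ ρp) := by
    set T0 := Θ (0 + ℓ / W 0) - Θ 0 with hT0
    have hint : ∀ x, T0 = ∫ s in x..(x + ℓ / W x), q s := by
      intro x
      rw [← hconst x]
      simp only [hΘ]
      rw [intervalIntegral.integral_interval_sub_left (hqc.intervalIntegrable _ _)
        (hqc.intervalIntegrable _ _)]
    have hlp : ∀ x, 0 < ℓ / W x := fun x => div_pos hℓ (hWmem x).1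
    have hb1 : ∀ x, ℓ / W x * (φ (W x))⁻¹ ≤ T0 := by
      intro x
      have : (∫ s in x..(x + ℓ / W x), (φ (W x))⁻¹) ≤ ∫ s in x..(x + ℓ / W x), q s := by
        apply intervalIntegral.integral_mono_on (by linarith [hlp x]) (by simp)
          (hqc.intervalIntegrable _ _)
        intro s hs
        apply inv_anti₀ (hφW s)
        exact hanti ⟨(hWmem x).1.le, (hWmem x).2.le⟩ ⟨(hWmem s).1.le, (hWmem s).2.le⟩ (hWmono hs.1)
      rw [hint x]
      simpa using this
    have hb2 : ∀ x, T0 ≤ ℓ / W x * (φ ρp)⁻¹ := by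
      intro x
      have : (∫ s in x..(x + ℓ / W x), q s) ≤ (∫ s in x..(x + ℓ / W x), (φ ρp)⁻¹) := by
        apply intervalIntegral.integral_mono_on (by linarith [hlp x])
          (hqc.intervalIntegrable _ _) (by simp)
        intro s hs
        apply inv_anti₀ hφp
        exact hanti ⟨(hWmem s).1.le, (hWmem s).2.le⟩ ⟨hρ0.le, hρ1.le⟩ (hWle s)
      rw [hint x]
      simpa using this
    have hl0 : Tendsto (fun x => ℓ / W x) atTop (𝓝 (ℓ / ρp)) :=
      tendsto_const_nhds.div hWlimp hρ0.ne'
    have hl1 : Tendsto (fun x => ℓ / W x * (φ (W x))⁻¹) atTop (𝓝 (ℓ / ρp * (φ ρp)⁻¹)) :=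
      hl0.mul (((hφc.tendsto ρp).comp hWlimp).inv₀ hφp.ne')
    have hl2 : Tendsto (fun x => ℓ / W x * (φ ρp)⁻¹) atTop (𝓝 (ℓ / ρp * (φ ρp)⁻¹)) :=
      hl0.mul_const _
    have i1 := le_of_tendsto hl1 (Eventually.of_forall hb1)
    have i2 := ge_of_tendsto hl2 (Eventually.of_forall hb2)
    have : ℓ / ρp * (φ ρp)⁻¹ = ℓ / (ρp * φ ρp) := by field_simp
    linarith
  refine ⟨z, e.symm.surjective, e.symm.monotone, e.symm.tendsto_atTop, ?_, ?_⟩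
  · intro t
    have := HasDerivAt.of_local_left_inverse (f := Θ) (g := z) (a := t)
      (e.symm.continuous.continuousAt) (hΘd (z t)) (by linarith [hq1 (z t)] |> fun h : 0 < q (z t) => h.ne')
      (Eventually.of_forall hΘz)
    simpa [hq] using this
  · intro t
    have := hconst (z t)
    rw [hT, hΘz] at this
    have h2 : t + ℓ / (ρp * φ ρp) = Θ (z t + ℓ / W (z t)) := by linarith
    rw [h2, hzΘ]

lemma tw_h (ℓ ρm ρp C : ℝ) (hℓ : 0 < ℓ) (hm : 0 < ρm) (hmp : ρm < ρp) (hp : ρp < 1)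
    (φ G : ℝ → ℝ) (hφd : Differentiable ℝ φ)
    (hG : ∀ ρ, G ρ = -deriv φ ρ * ρ ^ 2 / ℓ)
    (hG0 : ∀ ρ ∈ Icc ρm ρp, 0 ≤ G ρ) (hGp : ∀ ρ ∈ Icc ρm ρp, G ρ ≤ G ρp) (hC : 0 ≤ C)
    (hGC : ∀ ρ ∈ Icc ρm ρp, G ρp - G ρ ≤ C * (ρp - ρ)) :
    (∀ x ∈ Icc 0 (ℓ / ρm - ℓ / ρp), ∀ y ∈ Icc 0 (ℓ / ρm - ℓ / ρp),
      |(φ (ℓ / (ℓ / ρp + x)) - φ ρp) - (φ (ℓ / (ℓ / ρp + y)) - φ ρp)| ≤ G ρp * |x - y|) ∧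
    (∀ x ∈ Icc 0 (ℓ / ρm - ℓ / ρp),
      G ρp * x - (C / ℓ) * x ^ 2 ≤ φ (ℓ / (ℓ / ρp + x)) - φ ρp) := by
  have hp0 : 0 < ρp := hm.trans hmp
  set B := ℓ / ρm - ℓ / ρp with hB
  have hu0 : 0 < ℓ / ρp := by positivity
  have hrm : ∀ x ∈ Icc 0 B, ℓ / (ℓ / ρp + x) ∈ Icc ρm ρp := by
    intro x hx
    have hx0 := hx.1
    have hx1 := hx.2
    have hpos : 0 < ℓ / ρp + x := by linarith
    constructor
    · rw [le_div_iff₀ hpos]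
      calc ρm * (ℓ / ρp + x) ≤ ρm * (ℓ / ρm) := by
            apply mul_le_mul_of_nonneg_left _ hm.le; linarith
        _ = ℓ := by field_simp
    · rw [div_le_iff₀ hpos]
      calc ℓ = ρp * (ℓ / ρp) := by field_simp
        _ ≤ _ := by apply mul_le_mul_of_nonneg_left _ hp0.le; linarith
  have hd : ∀ x ∈ Icc 0 B, HasDerivAt (fun x => φ (ℓ / (ℓ / ρp + x)) - φ ρp)
      (G (ℓ / (ℓ / ρp + x))) x := by
    intro x hx
    have hpos : 0 < ℓ / ρp + x := by linarith [hx.1]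
    have h1 : HasDerivAt (fun x => ℓ / (ℓ / ρp + x)) (ℓ * (-1 / (ℓ / ρp + x) ^ 2)) x := by
      have := (((hasDerivAt_id x).const_add (ℓ / ρp)).inv hpos.ne').const_mul ℓ
      simpa [div_eq_mul_inv] using this
    have h2 := HasDerivAt.comp x (hφd (ℓ / (ℓ / ρp + x))).hasDerivAt h1
    refine (h2.sub_const (φ ρp)).congr_deriv ?_
    rw [hG]
    generalize ℓ / ρp + x = u at *
    have := hpos.ne'
    field_simp
  constructor
  · intro x hx y hy
    have := (convex_Icc (0:ℝ) B).norm_image_sub_le_of_norm_hasDerivWithin_le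
      (f := fun x => φ (ℓ / (ℓ / ρp + x)) - φ ρp) (C := G ρp)
      (fun x hx => (hd x hx).hasDerivWithinAt)
      (fun x hx => by
        rw [Real.norm_eq_abs, abs_of_nonneg (hG0 _ (hrm x hx))]; exact hGp _ (hrm x hx)) hy hx
    simpa [Real.norm_eq_abs] using this
  · have hF : ∀ x ∈ Icc 0 B, HasDerivAt
        (fun x => φ (ℓ / (ℓ / ρp + x)) - φ ρp - (G ρp * x - (C / ℓ) * x ^ 2))
        (G (ℓ / (ℓ / ρp + x)) - (G ρp - (C / ℓ) * (2 * x))) x := by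
      intro x hx
      have h1 := (hasDerivAt_id x).const_mul (G ρp)
      have h2 := ((hasDerivAt_id x).pow 2).const_mul (C / ℓ)
      refine ((hd x hx).sub (h1.sub h2)).congr_deriv ?_
      simp
    have hmono : MonotoneOn
        (fun x => φ (ℓ / (ℓ / ρp + x)) - φ ρp - (G ρp * x - (C / ℓ) * x ^ 2)) (Icc 0 B) := by
      apply monotoneOn_of_deriv_nonneg (convex_Icc 0 B)
        (fun t ht => (hF t ht).continuousAt.continuousWithinAt)
        (fun t ht => (hF t (interior_subset ht)).differentiableAt.differentiableWithinAt)
      intro x hx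
      have hx := interior_subset hx
      rw [(hF x hx).deriv]
      have e1 := hGC _ (hrm x hx)
      have hx0 := hx.1
      have e2 : ρp - ℓ / (ℓ / ρp + x) ≤ x / ℓ := by
        have hpos : 0 < ℓ + ρp * x := by positivity
        have : ρp - ℓ / (ℓ / ρp + x) = ρp ^ 2 * x / (ℓ + ρp * x) := by
          field_simp
          ring
        rw [this, div_le_div_iff₀ hpos hℓ]
        have : ρp ^ 2 ≤ 1 := by nlinarith
        nlinarith [mul_nonneg hx0 hℓ.le, mul_nonneg hp0.le (mul_nonneg hx0 hx0)]
      have e3 := mul_le_mul_of_nonneg_left e2 hC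
      have e4 : C * (x / ℓ) = C / ℓ * x := by ring
      have e5 : 0 ≤ C / ℓ * x := by positivity
      linarith
    intro x hx
    have := hmono ⟨le_rfl, hx.1.trans hx.2⟩ hx hx.1
    have e : ℓ / (ℓ / ρp) = ρp := by field_simp
    simp only [add_zero, e, mul_zero] at this
    linarith

lemma tw_v (ℓ ρm ρp T : ℝ) (hℓ : 0 < ℓ) (hm : 0 < ρm) (hmp : ρm < ρp)
    (φ : ℝ → ℝ) (hφc : Continuous φ) (hT : T * φ ρp = ℓ / ρp)
    (W z : ℝ → ℝ) (hWmem : ∀ x, W x ∈ Ioo (0:ℝ) 1)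
    (hWmono : Monotone W) (hWc : Continuous W)
    (hWlimm : Tendsto W atBot (𝓝 ρm)) (hWlimp : Tendsto W atTop (𝓝 ρp))
    (hzs : Function.Surjective z) (hzm : Monotone z) (hzt : Tendsto z atTop atTop)
    (hzd : ∀ t, HasDerivAt z (φ (W (z t))) t) (hz : ∀ t, z (t + T) = z t + ℓ / W (z t)) :
    Continuous (fun t => ℓ / W (z t) - ℓ / ρp) ∧ Antitone (fun t => ℓ / W (z t) - ℓ / ρp) ∧
    (∀ t, ℓ / W (z t) - ℓ / ρp ∈ Icc 0 (ℓ / ρm - ℓ / ρp)) ∧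
    (Continuous fun t => φ (ℓ / (ℓ / ρp + (ℓ / W (z t) - ℓ / ρp))) - φ ρp) ∧
    Tendsto (fun t => ℓ / W (z t) - ℓ / ρp) atTop (𝓝 0) ∧
    (∃ t, 0 < ℓ / W (z t) - ℓ / ρp) ∧
    ∀ t, ℓ / W (z t) - ℓ / ρp =
      ∫ s in t..t+T, (φ (ℓ / (ℓ / ρp + (ℓ / W (z s) - ℓ / ρp))) - φ ρp) := by
  have hp0 : 0 < ρp := hm.trans hmp
  have hW0 : ∀ x, 0 < W x := fun x => (hWmem x).1
  have hzc : Continuous z := continuous_iff_continuousAt.2 fun x => (hzd x).continuousAt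
  have hWle : ∀ x, W x ≤ ρp := fun x => hWmono.ge_of_tendsto hWlimp x
  have hWge : ∀ x, ρm ≤ W x := fun x => hWmono.le_of_tendsto hWlimm x
  have hsimp : ∀ t, ℓ / (ℓ / ρp + (ℓ / W (z t) - ℓ / ρp)) = W (z t) := by
    intro t
    have := (hW0 (z t)).ne'
    rw [add_sub_cancel]; field_simp
  have hφWc : Continuous fun t => φ (W (z t)) := by fun_prop
  simp only [hsimp]
  refine ⟨?_, ?_, ?_, ?_, ?_, ?_, ?_⟩
  · exact (continuous_const.div (hWc.comp hzc) fun t => (hW0 (z t)).ne').sub continuous_const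
  · intro s t hst
    have := div_le_div_of_nonneg_left hℓ.le (hW0 (z s)) (hWmono (hzm hst))
    simp only; linarith
  · intro t
    have h1 := div_le_div_of_nonneg_left hℓ.le (hW0 (z t)) (hWle (z t))
    have h2 := div_le_div_of_nonneg_left hℓ.le hm (hWge (z t))
    constructor <;> linarith
  · exact hφWc.sub continuous_const
  · have := ((tendsto_const_nhds (x := ℓ)).div (hWlimp.comp hzt) hp0.ne').sub_const (ℓ / ρp)
    rw [sub_self] at this
    exact this
  · obtain ⟨x, hx⟩ := (hWlimm.eventually (gt_mem_nhds hmp)).exists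
    obtain ⟨t, rfl⟩ := hzs x
    refine ⟨t, ?_⟩
    have := div_lt_div_of_pos_left hℓ (hW0 (z t)) hx
    linarith
  · intro t
    rw [intervalIntegral.integral_sub (hφWc.intervalIntegrable _ _) (by simp),
      intervalIntegral.integral_eq_sub_of_hasDerivAt (fun s _ => hzd s)
        (hφWc.intervalIntegrable _ _), hz t]
    simp only [intervalIntegral.integral_const, smul_eq_mul]
    rw [add_sub_cancel_left, add_sub_cancel_left, hT]


/-- Uniqueness up to shift: two differentiable monotone
increasing solutions of the profile DDE with the same limits `ρ₋` at `−∞`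
and `ρ₊` at `+∞` (`0 < ρ₋ < ρ* < ρ₊ < 1`, `f(ρ₋) = f(ρ₊)`) coincide after a
horizontal shift. -/
theorem traveling_wave_profile_unique_up_to_shift
    (ℓ V c0 chat ρstar ρm ρp : ℝ)
    (hℓ : 0 < ℓ) (hV : 0 < V) (hc0 : 0 < c0) (hchat : 0 < chat)
    (φ : ℝ → ℝ) (hφs : ContDiff ℝ (⊤ : ℕ∞) φ)
    (hφ1 : φ 1 = 0) (hφ0 : φ 0 = 1)
    (hφ' : ∀ ρ ∈ Set.Icc (0:ℝ) 1, deriv φ ρ ≤ -chat)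
    (f : ℝ → ℝ) (hf : ∀ ρ, f ρ = V * ρ * φ ρ)
    (hf'' : ∀ ρ ∈ Set.Icc (0:ℝ) 1, deriv (deriv f) ρ ≤ -c0)
    (hρstar : ρstar ∈ Set.Ioo (0:ℝ) 1) (hρstarcrit : deriv f ρstar = 0)
    (hρm0 : 0 < ρm) (hρms : ρm < ρstar) (hρsp : ρstar < ρp) (hρp1 : ρp < 1)
    (hfeq : f ρm = f ρp)
    (W Wbar : ℝ → ℝ)
    (hWmem : ∀ x, W x ∈ Set.Ioo (0:ℝ) 1)
    (hWmono : Monotone W) (hWd : Differentiable ℝ W)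
    (hdde : ∀ x, deriv W x =
      W x ^ 2 / (ℓ * φ (W x)) * (φ (W x) - φ (W (x + ℓ / W x))))
    (hWlimm : Filter.Tendsto W Filter.atBot (nhds ρm))
    (hWlimp : Filter.Tendsto W Filter.atTop (nhds ρp))
    (hWbarmem : ∀ x, Wbar x ∈ Set.Ioo (0:ℝ) 1)
    (hWbarmono : Monotone Wbar) (hWbard : Differentiable ℝ Wbar)
    (hddebar : ∀ x, deriv Wbar x =
      Wbar x ^ 2 / (ℓ * φ (Wbar x)) * (φ (Wbar x) - φ (Wbar (x + ℓ / Wbar x))))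
    (hWbarlimm : Filter.Tendsto Wbar Filter.atBot (nhds ρm))
    (hWbarlimp : Filter.Tendsto Wbar Filter.atTop (nhds ρp)) :
    ∃ c : ℝ, ∀ x : ℝ, Wbar x = W (x + c) := by
  have hφd : Differentiable ℝ φ := hφs.differentiable (by simp)
  have hφ1s : ContDiff ℝ (⊤ : ℕ∞) (deriv φ) := by
    have : ContDiff ℝ ((⊤ : ℕ∞) + 1) φ := by simpa using hφs
    exact (contDiff_succ_iff_deriv.1 this).2.2
  have hφd2 : Differentiable ℝ (deriv φ) := hφ1s.differentiable (by simp)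
  have hφc2 : Continuous (deriv (deriv φ)) := hφ1s.continuous_deriv (by simp)
  have hsanti : StrictAntiOn φ (Icc 0 1) := by
    apply strictAntiOn_of_deriv_neg (convex_Icc 0 1) hφd.continuous.continuousOn
    intro x hx
    have := hφ' x (interior_subset hx)
    linarith
  have hpos : ∀ ρ ∈ Ioo (0:ℝ) 1, 0 < φ ρ := by
    intro ρ hρ
    rw [← hφ1]
    exact hsanti ⟨hρ.1.le, hρ.2.le⟩ ⟨by norm_num, le_rfl⟩ hρ.2
  have hle : ∀ ρ ∈ Ioo (0:ℝ) 1, φ ρ ≤ 1 := by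
    intro ρ hρ
    rw [← hφ0]
    exact hsanti.antitoneOn ⟨le_rfl, by norm_num⟩ ⟨hρ.1.le, hρ.2.le⟩ hρ.1.le
  have hmp : ρm < ρp := hρms.trans hρsp
  have hp0 : 0 < ρp := hρm0.trans hmp
  have hφp := hpos ρp ⟨hp0, hρp1⟩
  have hf1 : ∀ x, HasDerivAt f (V * φ x + V * x * deriv φ x) x := by
    intro x
    have h1 := ((hasDerivAt_id x).const_mul V).mul (hφd x).hasDerivAt
    have h2 : f = fun x => V * x * φ x := funext hf
    rw [h2]
    refine h1.congr_deriv ?_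
    simp
  have hf1' : deriv f = fun x => V * φ x + V * x * deriv φ x := funext fun x => (hf1 x).deriv
  have hf2 : ∀ x, HasDerivAt (deriv f) (V * (2 * deriv φ x + x * deriv (deriv φ) x)) x := by
    intro x
    rw [hf1']
    have h1 := ((hφd x).hasDerivAt.const_mul V).add
      (((hasDerivAt_id x).const_mul V).mul (hφd2 x).hasDerivAt)
    refine h1.congr_deriv ?_
    simp
    ring
  have hf2le : ∀ x ∈ Icc (0:ℝ) 1, 2 * deriv φ x + x * deriv (deriv φ) x < 0 := by
    intro x hx
    have := hf'' x hx
    rw [(hf2 x).deriv] at this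
    by_contra hcon
    push Not at hcon
    nlinarith [mul_nonneg hV.le hcon]
  have hf'p : deriv f ρp < 0 := by
    rw [← hρstarcrit]
    have hanti : StrictAntiOn (deriv f) (Icc 0 1) := by
      apply strictAntiOn_of_deriv_neg (convex_Icc 0 1)
        (fun x _ => (hf2 x).continuousAt.continuousWithinAt)
      intro x hx
      have := hf'' x (interior_subset hx)
      linarith
    exact hanti ⟨hρstar.1.le, hρstar.2.le⟩ ⟨hp0.le, hρp1.le⟩ hρsp
  set G : ℝ → ℝ := fun ρ => -deriv φ ρ * ρ ^ 2 / ℓ with hGdef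
  have hGd : ∀ x, HasDerivAt G (-(x * (2 * deriv φ x + x * deriv (deriv φ) x)) / ℓ) x := by
    intro x
    have h1 := (((hφd2 x).hasDerivAt.neg).mul ((hasDerivAt_id x).pow 2)).div_const ℓ
    refine h1.congr_deriv ?_
    simp
    ring
  have hGmono : MonotoneOn G (Icc 0 1) := by
    apply monotoneOn_of_deriv_nonneg (convex_Icc 0 1)
      (fun t ht => (hGd t).continuousAt.continuousWithinAt)
      (fun t ht => (hGd t).differentiableAt.differentiableWithinAt)
    intro x hx
    have hx := interior_subset hx
    rw [(hGd x).deriv]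
    apply div_nonneg _ hℓ.le
    have := mul_nonpos_of_nonneg_of_nonpos hx.1 (hf2le x hx).le
    linarith
  have hsub : Icc ρm ρp ⊆ Icc 0 1 := Icc_subset_Icc hρm0.le hρp1.le
  obtain ⟨C, hCb⟩ := (isCompact_Icc (a := (0:ℝ)) (b := 1)).exists_bound_of_continuousOn
    (f := fun x => -(x * (2 * deriv φ x + x * deriv (deriv φ) x)) / ℓ)
    (by
      have h1 : Continuous (deriv φ) := hφd2.continuous
      apply Continuous.continuousOn
      fun_prop)
  have hC0 : 0 ≤ C := (norm_nonneg _).trans (hCb 0 ⟨le_rfl, by norm_num⟩)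
  have hpm : ρp ∈ Icc (0:ℝ) 1 := ⟨hp0.le, hρp1.le⟩
  have hGC : ∀ ρ ∈ Icc ρm ρp, G ρp - G ρ ≤ C * (ρp - ρ) := by
    intro ρ hρ
    have := (convex_Icc (0:ℝ) 1).norm_image_sub_le_of_norm_hasDerivWithin_le
      (f := G) (C := C) (fun x hx => (hGd x).hasDerivWithinAt) hCb (hsub hρ) hpm
    rw [Real.norm_eq_abs, Real.norm_eq_abs, abs_of_nonneg (sub_nonneg.2 hρ.2)] at this
    exact (le_abs_self _).trans this
  have hG0 : ∀ ρ ∈ Icc ρm ρp, 0 ≤ G ρ := by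
    intro ρ hρ
    have := hφ' ρ (hsub hρ)
    simp only [hGdef]
    apply div_nonneg (mul_nonneg (by linarith) (sq_nonneg _)) hℓ.le
  obtain ⟨hlip, hlow⟩ := tw_h ℓ ρm ρp C hℓ hρm0 hmp hρp1 φ G hφd (fun _ => rfl) hG0
    (fun ρ hρ => hGmono (hsub hρ) hpm hρ.2) hC0 hGC
  set T := ℓ / (ρp * φ ρp) with hTdef
  have hTpos : 0 < T := by positivity
  have hTφ : T * φ ρp = ℓ / ρp := by rw [hTdef]; field_simp
  have haT : 1 < G ρp * T := by
    rw [hf1'] at hf'p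
    simp only at hf'p
    have h1 : φ ρp + ρp * deriv φ ρp < 0 := by
      by_contra hcon
      push Not at hcon
      nlinarith [mul_nonneg hV.le hcon]
    have h2 : G ρp * T = -(ρp * deriv φ ρp) / φ ρp := by
      simp only [hGdef, hTdef]; field_simp
    rw [h2, lt_div_iff₀ hφp]
    linarith
  obtain ⟨z, hzs, hzm, hzt, hzd, hz⟩ := tw_param ℓ ρp hℓ hp0 hρp1 φ hφd.continuous hpos hle
    hsanti.antitoneOn W hWmem hWmono hWd hdde hWlimp
  obtain ⟨zb, hzbs, hzbm, hzbt, hzbd, hzb⟩ := tw_param ℓ ρp hℓ hp0 hρp1 φ hφd.continuous hpos hle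
    hsanti.antitoneOn Wbar hWbarmem hWbarmono hWbard hddebar hWbarlimp
  obtain ⟨v1, v2, v3, v4, v5, v6, v7⟩ := tw_v ℓ ρm ρp T hℓ hρm0 hmp φ hφd.continuous hTφ W z
    hWmem hWmono hWd.continuous hWlimm hWlimp hzs hzm hzt hzd hz
  obtain ⟨w1, w2, w3, w4, w5, w6, w7⟩ := tw_v ℓ ρm ρp T hℓ hρm0 hmp φ hφd.continuous hTφ Wbar zb
    hWbarmem hWbarmono hWbard.continuous hWbarlimm hWbarlimp hzbs hzbm hzbt hzbd hzb
  obtain ⟨c, hc⟩ := tw_abs (G ρp) T (C / ℓ) (ℓ / ρm - ℓ / ρp) hTpos haT (by positivity)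
    (fun x => φ (ℓ / (ℓ / ρp + x)) - φ ρp) hlip
    (by
      have e : ℓ / (ℓ / ρp) = ρp := by field_simp
      simp [e]) hlow
    (fun t => ℓ / W (z t) - ℓ / ρp) (fun t => ℓ / Wbar (zb t) - ℓ / ρp)
    v1 v2 v3 v4 v5 v6 v7 w1 w2 w3 w4 w5 w6 w7
  have hWW : ∀ t, Wbar (zb t) = W (z (t + c)) := by
    intro t
    have h1 := hc t
    simp only [sub_left_inj] at h1
    have a1 := (hWbarmem (zb t)).1.ne'
    have a2 := (hWmem (z (t + c))).1.ne'
    rw [div_eq_div_iff a1 a2] at h1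
    exact (mul_left_cancel₀ hℓ.ne' h1).symm
  have hdd : ∀ t, HasDerivAt (fun t => z (t + c) - zb t) 0 t := by
    intro t
    refine ((HasDerivAt.comp_add_const t c (hzd (t + c))).sub (hzbd t)).congr_deriv ?_
    rw [hWW]; simp
  refine ⟨z (0 + c) - zb 0, fun x => ?_⟩
  obtain ⟨t, rfl⟩ := hzbs x
  have := is_const_of_deriv_eq_zero (fun x => (hdd x).differentiableAt) (fun x => (hdd x).deriv) t 0
  rw [hWW, ← this]
  congr 1
  ring
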